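/- For any states ρ and σ on the same bipartite system with the support of ρ contained in the support of σ, the p.p.t. distillable entanglement satisfies D_Γ(ρ) ≤ S(ρ||σ) + log₂ Tr|σ^Γ|. -/

import Mathlib

open Matrix Filter
open scoped ComplexOrder

noncomputable section

/-- Partial transpose on the second tensor factor:
`ptrans M ((i,j),(k,l)) = M ((i,l),(k,j))`. -/
def ptrans {ι κ : Type*} (M : Matrix (ι × κ) (ι × κ) ℂ) : Matrix (ι × κ) (ι × κ) ℂ :=
  fun x y => M (x.1, y.2) (y.1, x.2)

/-- Fidelity of `K`-state p.p.t. distillation: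
the supremum of `Tr(Fρ)` over Hermitian `F` with `0 ≤ F ≤ 1` and `-1/K ≤ F^Γ ≤ 1/K`. -/
def FGamma {ι κ : Type*} [Fintype ι] [Fintype κ] [DecidableEq ι] [DecidableEq κ]
    (ρ : Matrix (ι × κ) (ι × κ) ℂ) (K : ℝ) : ℝ :=
  sSup {x : ℝ | ∃ F : Matrix (ι × κ) (ι × κ) ℂ,
    F.PosSemidef ∧ (1 - F).PosSemidef ∧
    (((1 / K : ℝ) : ℂ) • 1 - ptrans F).PosSemidef ∧
    (ptrans F + ((1 / K : ℝ) : ℂ) • 1).PosSemidef ∧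
    x = ((F * ρ).trace).re}

/-- `n`-fold tensor power of a bipartite matrix, regrouped as a bipartite matrix. -/
def tpow {ι κ : Type*} (ρ : Matrix (ι × κ) (ι × κ) ℂ) (n : ℕ) :
    Matrix ((Fin n → ι) × (Fin n → κ)) ((Fin n → ι) × (Fin n → κ)) ℂ :=
  fun x y => ∏ i, ρ (x.1 i, x.2 i) (y.1 i, y.2 i)

/-- p.p.t. distillable entanglement. -/
def DGamma {ι κ : Type*} [Fintype ι] [Fintype κ] [DecidableEq ι] [DecidableEq κ]
    (ρ : Matrix (ι × κ) (ι × κ) ℂ) : ℝ :=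
  sSup {r : ℝ | 0 ≤ r ∧
    Tendsto (fun n : ℕ => FGamma (tpow ρ n) ((⌊(2 : ℝ) ^ (r * (n : ℝ))⌋ : ℤ) : ℝ))
      atTop (nhds 1)}

/-- Trace of the positive part of a Hermitian matrix: `Tr(A₊) = ∑ᵢ max(λᵢ, 0)`. -/
def tracePos {n : Type*} [Fintype n] [DecidableEq n] (A : Matrix n n ℂ) : ℝ :=
  if h : A.IsHermitian then ∑ i, max (h.eigenvalues i) 0 else 0

/-- Trace norm of a Hermitian matrix: `Tr|A| = ∑ᵢ |λᵢ|`. -/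
def traceAbs {n : Type*} [Fintype n] [DecidableEq n] (A : Matrix n n ℂ) : ℝ :=
  if h : A.IsHermitian then ∑ i, |h.eigenvalues i| else 0

/-- Base-2 logarithm of a Hermitian matrix via the spectral theorem
(with the convention `log 0 = 0` on the kernel, and junk value `0` otherwise). -/
def hermLog2 {n : Type*} [Fintype n] [DecidableEq n] (A : Matrix n n ℂ) : Matrix n n ℂ :=
  if h : A.IsHermitian then
    (h.eigenvectorUnitary : Matrix n n ℂ) *
      Matrix.diagonal (fun i => ((Real.logb 2 (h.eigenvalues i) : ℝ) : ℂ)) *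
      star (h.eigenvectorUnitary : Matrix n n ℂ)
  else 0

/-- Relative entropy `S(ρ‖σ) = Tr(ρ (log₂ ρ - log₂ σ))`. -/
def relEnt {n : Type*} [Fintype n] [DecidableEq n] (ρ σ : Matrix n n ℂ) : ℝ :=
  ((ρ * (hermLog2 ρ - hermLog2 σ)).trace).re

/-! ### Sums over tensor-power indices -/

lemma sum_prod_pair {ι κ R : Type*} [Fintype ι] [Fintype κ] [CommSemiring R] {n : ℕ}
    (g : Fin n → ι × κ → R) :
    ∑ x : (Fin n → ι) × (Fin n → κ), ∏ k, g k (x.1 k, x.2 k) = ∏ k, ∑ z, g k z := by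
  classical
  rw [Finset.prod_univ_sum, Fintype.piFinset_univ,
    ← (Equiv.arrowProdEquivProdArrow (Fin n) (fun _ => ι) (fun _ => κ)).sum_comp]
  rfl

lemma sum_sum_prod_pair {ι κ R : Type*} [Fintype ι] [Fintype κ] [CommSemiring R] {n : ℕ}
    (g : Fin n → ι × κ → ι × κ → R) :
    ∑ x : (Fin n → ι) × (Fin n → κ), ∑ y : (Fin n → ι) × (Fin n → κ),
      ∏ k, g k (x.1 k, x.2 k) (y.1 k, y.2 k) = ∏ k, ∑ z, ∑ w, g k z w := by
  rw [← sum_prod_pair]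
  exact Finset.sum_congr rfl fun x _ => sum_prod_pair fun k => g k (x.1 k, x.2 k)

/-- Expectation of an additive function under a product distribution. -/
lemma sum_sum_prod_mul_sum {ι κ : Type*} [Fintype ι] [Fintype κ] {n : ℕ}
    (P f : ι × κ → ι × κ → ℝ) (hP : ∑ z, ∑ w, P z w = 1) :
    ∑ x : (Fin n → ι) × (Fin n → κ), ∑ y : (Fin n → ι) × (Fin n → κ),
      (∏ k, P (x.1 k, x.2 k) (y.1 k, y.2 k)) * ∑ k, f (x.1 k, x.2 k) (y.1 k, y.2 k)
      = n * ∑ z, ∑ w, P z w * f z w := by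
  have h : ∀ l : Fin n, ∑ x : (Fin n → ι) × (Fin n → κ), ∑ y : (Fin n → ι) × (Fin n → κ),
      (∏ k, P (x.1 k, x.2 k) (y.1 k, y.2 k)) * f (x.1 l, x.2 l) (y.1 l, y.2 l)
      = ∑ z, ∑ w, P z w * f z w := by
    intro l
    have h1 := sum_sum_prod_pair (fun k z w => P z w * if k = l then f z w else 1)
    have h2 : ∀ k, ∑ z, ∑ w, (P z w * if k = l then f z w else 1)
        = if k = l then ∑ z, ∑ w, P z w * f z w else 1 := by
      intro k
      split_ifs
      · rfl
      · simpa using hP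
    simpa only [h2, Finset.prod_mul_distrib, Finset.prod_ite_eq', Finset.mem_univ, if_true] using h1
  simp_rw [Finset.mul_sum]
  calc _ = ∑ l : Fin n, ∑ x : (Fin n → ι) × (Fin n → κ), ∑ y : (Fin n → ι) × (Fin n → κ),
      (∏ k, P (x.1 k, x.2 k) (y.1 k, y.2 k)) * f (x.1 l, x.2 l) (y.1 l, y.2 l) :=
        (Finset.sum_congr rfl fun x _ => Finset.sum_comm).trans Finset.sum_comm
    _ = _ := by
        simp_rw [h]
        simp [Finset.mul_sum]

/-! ### Tensor powers -/

lemma tpow_mul {ι κ : Type*} [Fintype ι] [Fintype κ] (A B : Matrix (ι × κ) (ι × κ) ℂ) (n : ℕ) :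
    tpow (A * B) n = tpow A n * tpow B n := by
  ext x y
  simp only [tpow, Matrix.mul_apply, ← Finset.prod_mul_distrib]
  exact (sum_prod_pair fun k z => A (x.1 k, x.2 k) z * B z (y.1 k, y.2 k)).symm

lemma tpow_conjTranspose {ι κ : Type*} (A : Matrix (ι × κ) (ι × κ) ℂ) (n : ℕ) :
    tpow Aᴴ n = (tpow A n)ᴴ := by
  ext x y
  simp [tpow, Matrix.conjTranspose_apply]

lemma tpow_diagonal {ι κ : Type*} [DecidableEq ι] [DecidableEq κ] (d : ι × κ → ℝ) (n : ℕ) :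
    tpow (diagonal fun i => (d i : ℂ)) n
      = diagonal fun x => ((∏ k, d (x.1 k, x.2 k) : ℝ) : ℂ) := by
  ext x y
  by_cases h : x = y
  · subst h
    simp [tpow]
  · rw [diagonal_apply_ne _ h]
    by_contra h0
    rw [tpow, Finset.prod_eq_zero_iff] at h0
    push Not at h0
    have h1 : ∀ k, (x.1 k, x.2 k) = (y.1 k, y.2 k) := fun k => by
      by_contra hk
      exact h0 k (Finset.mem_univ k) (diagonal_apply_ne _ hk)
    simp only [Prod.mk.injEq] at h1
    exact h (Prod.ext (funext fun k => (h1 k).1) (funext fun k => (h1 k).2))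

lemma tpow_one {ι κ : Type*} [DecidableEq ι] [DecidableEq κ] (n : ℕ) :
    tpow (1 : Matrix (ι × κ) (ι × κ) ℂ) n = 1 := by
  simpa using tpow_diagonal (fun _ : ι × κ => 1) n

lemma ptrans_tpow {ι κ : Type*} (A : Matrix (ι × κ) (ι × κ) ℂ) (n : ℕ) :
    ptrans (tpow A n) = tpow (ptrans A) n := rfl

lemma trace_ptrans_mul_ptrans {ι κ : Type*} [Fintype ι] [Fintype κ]
    (A B : Matrix (ι × κ) (ι × κ) ℂ) :
    (ptrans A * ptrans B).trace = (A * B).trace := by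
  simp only [Matrix.trace, Matrix.diag_apply, Matrix.mul_apply, ptrans, Fintype.sum_prod_type]
  refine Finset.sum_congr rfl fun i _ => ?_
  rw [Finset.sum_comm]
  conv_rhs => rw [Finset.sum_comm]
  refine Finset.sum_congr rfl fun i' _ => ?_
  rw [Finset.sum_comm]

lemma trace_ptrans {ι κ : Type*} [Fintype ι] [Fintype κ] (A : Matrix (ι × κ) (ι × κ) ℂ) :
    (ptrans A).trace = A.trace := rfl

lemma ptrans_isHermitian {ι κ : Type*} {A : Matrix (ι × κ) (ι × κ) ℂ} (hA : A.IsHermitian) :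
    (ptrans A).IsHermitian := by
  ext x y
  exact hA.apply _ _

/-! ### Spectral decompositions -/

/-- `A = U diag(d) Uᴴ` with `U` unitary and `d` real. -/
structure IsSpectralDecomp {m : Type*} [Fintype m] [DecidableEq m]
    (A U : Matrix m m ℂ) (d : m → ℝ) : Prop where
  conj_mul : Uᴴ * U = 1
  mul_conj : U * Uᴴ = 1
  eq : A = U * diagonal (fun i => (d i : ℂ)) * Uᴴ

lemma Matrix.IsHermitian.isSpectralDecomp {m : Type*} [Fintype m] [DecidableEq m]
    {A : Matrix m m ℂ} (hA : A.IsHermitian) :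
    IsSpectralDecomp A (hA.eigenvectorUnitary : Matrix m m ℂ) hA.eigenvalues where
  conj_mul := Matrix.mem_unitaryGroup_iff'.1 hA.eigenvectorUnitary.2
  mul_conj := Matrix.mem_unitaryGroup_iff.1 hA.eigenvectorUnitary.2
  eq := by
    conv_lhs => rw [hA.spectral_theorem]
    rfl

lemma IsSpectralDecomp.tpow {ι κ : Type*} [Fintype ι] [Fintype κ] [DecidableEq ι] [DecidableEq κ]
    {A U : Matrix (ι × κ) (ι × κ) ℂ} {d : ι × κ → ℝ} (h : IsSpectralDecomp A U d) (n : ℕ) :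
    IsSpectralDecomp (tpow A n) (tpow U n) (fun x => ∏ k, d (x.1 k, x.2 k)) where
  conj_mul := by rw [← tpow_conjTranspose, ← tpow_mul, h.conj_mul, tpow_one]
  mul_conj := by rw [← tpow_conjTranspose, ← tpow_mul, h.mul_conj, tpow_one]
  eq := by
    conv_lhs => rw [h.eq]
    rw [tpow_mul, tpow_mul, tpow_diagonal, tpow_conjTranspose]

lemma mul_conjTranspose_diag {m : Type*} [Fintype m] (W : Matrix m m ℂ) (i : m) :
    ((W * Wᴴ) i i).re = ∑ j, Complex.normSq (W i j) := by
  simp [Matrix.mul_apply, Complex.mul_conj]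

lemma overlap_comm {m : Type*} [Fintype m] (U V : Matrix m m ℂ) (i j : m) :
    Complex.normSq ((Uᴴ * V) i j) = Complex.normSq ((Vᴴ * U) j i) := by
  have : Vᴴ * U = (Uᴴ * V)ᴴ := by simp
  rw [this, conjTranspose_apply]
  exact (Complex.normSq_conj _).symm

section

variable {m : Type*} [Fintype m] [DecidableEq m] {A B U V : Matrix m m ℂ} {a b : m → ℝ}

lemma IsSpectralDecomp.trace_mul (h : IsSpectralDecomp A U a) (F : Matrix m m ℂ) :
    ((F * A).trace).re = ∑ i, a i * ((Uᴴ * F * U) i i).re := by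
  have h1 : (F * A).trace = (Uᴴ * F * U * diagonal (fun i => (a i : ℂ))).trace := by
    rw [h.eq, ← Matrix.mul_assoc, Matrix.trace_mul_comm]
    simp only [Matrix.mul_assoc]
  rw [h1]
  simp [Matrix.trace, mul_diagonal, mul_comm]

lemma IsSpectralDecomp.trace_eq (h : IsSpectralDecomp A U a) : A.trace.re = ∑ i, a i := by
  simpa [h.conj_mul] using h.trace_mul 1

/-- The overlaps of two eigenbases have row sums `1`. -/
lemma IsSpectralDecomp.sum_overlap (hA : IsSpectralDecomp A U a) (hB : IsSpectralDecomp B V b)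
    (i : m) : ∑ j, Complex.normSq ((Uᴴ * V) i j) = 1 := by
  rw [← mul_conjTranspose_diag, conjTranspose_mul, conjTranspose_conjTranspose,
    Matrix.mul_assoc, ← Matrix.mul_assoc V, hB.mul_conj, Matrix.one_mul, hA.conj_mul]
  simp

/-- For `0 ≤ F ≤ 1`, a diagonal entry of `F` in the basis `U` dominates the one of `F²`. -/
lemma sum_normSq_le_of_effect {F : Matrix m m ℂ} (hF : F.PosSemidef) (hF1 : (1 - F).PosSemidef)
    (hV : V * Vᴴ = 1) (i : m) :
    ∑ j, Complex.normSq ((Uᴴ * F * V) i j) ≤ ((Uᴴ * F * U) i i).re := by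
  have h1 : (F - F * F).PosSemidef := by
    have e : F - F * F = Fᴴ * (1 - F) * F + (1 - F)ᴴ * F * (1 - F) := by
      rw [hF.1.eq, hF1.1.eq]
      noncomm_ring
    rw [e]
    exact (hF1.conjTranspose_mul_mul_same F).add (hF.conjTranspose_mul_mul_same (1 - F))
  have h2 := (h1.conjTranspose_mul_mul_same U).diag_nonneg (i := i)
  have h3 : Uᴴ * F * V * (Uᴴ * F * V)ᴴ = Uᴴ * (F * F) * U := by
    rw [conjTranspose_mul, conjTranspose_mul, conjTranspose_conjTranspose, hF.1.eq]
    calc _ = Uᴴ * F * (V * Vᴴ) * F * U := by simp only [Matrix.mul_assoc]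
      _ = _ := by rw [hV]; simp only [Matrix.mul_assoc, Matrix.one_mul]
  rw [← mul_conjTranspose_diag, h3]
  rw [Matrix.mul_sub, Matrix.sub_mul, Matrix.sub_apply] at h2
  have := (Complex.le_def.1 h2).1
  simpa using this

/-- Nussbaum–Szkoła bound: quantum hypothesis testing between `A` and `B` is, up to a factor
`1/2`, at least as hard as the classical problem given by the eigenvalues and the overlaps. -/
lemma IsSpectralDecomp.nussbaum_szkola (hA : IsSpectralDecomp A U a) (hB : IsSpectralDecomp B V b)
    (ha : ∀ i, 0 ≤ a i) (hb : ∀ i, 0 ≤ b i) {F : Matrix m m ℂ} (hF : F.PosSemidef)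
    (hF1 : (1 - F).PosSemidef) {l : ℝ} (hl : 0 ≤ l) :
    (∑ i, ∑ j, Complex.normSq ((Uᴴ * V) i j) * min (a i) (l * b j)) / 2
      ≤ (((1 - F) * A).trace).re + l * ((F * B).trace).re := by
  have h1 : ∑ i, ∑ j, a i * Complex.normSq ((Uᴴ * (1 - F) * V) i j)
      ≤ (((1 - F) * A).trace).re := by
    rw [hA.trace_mul]
    refine Finset.sum_le_sum fun i _ => ?_
    rw [← Finset.mul_sum]
    exact mul_le_mul_of_nonneg_left
      (sum_normSq_le_of_effect hF1 (by simpa using hF) hB.mul_conj i) (ha i)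
  have h2 : ∑ i, ∑ j, l * b j * Complex.normSq ((Uᴴ * F * V) i j)
      ≤ l * ((F * B).trace).re := by
    rw [hB.trace_mul, Finset.sum_comm, Finset.mul_sum]
    refine Finset.sum_le_sum fun j _ => ?_
    rw [← Finset.mul_sum, mul_assoc]
    refine mul_le_mul_of_nonneg_left (mul_le_mul_of_nonneg_left ?_ (hb j)) hl
    refine le_trans (le_of_eq (Finset.sum_congr rfl fun i _ => ?_))
      (sum_normSq_le_of_effect hF hF1 hA.mul_conj j)
    have : Vᴴ * F * U = (Uᴴ * F * V)ᴴ := by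
      simp [Matrix.mul_assoc, hF.1.eq]
    rw [this, conjTranspose_apply]
    exact (Complex.normSq_conj _).symm
  refine le_trans ?_ (add_le_add h1 h2)
  rw [← Finset.sum_add_distrib, Finset.sum_div]
  refine Finset.sum_le_sum fun i _ => ?_
  rw [← Finset.sum_add_distrib, Finset.sum_div]
  refine Finset.sum_le_sum fun j _ => ?_
  have hW : (Uᴴ * V) i j = (Uᴴ * (1 - F) * V) i j + (Uᴴ * F * V) i j := by
    rw [← Matrix.add_apply, ← Matrix.add_mul, ← Matrix.mul_add, sub_add_cancel, Matrix.mul_one]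
  rw [hW]
  generalize (Uᴴ * (1 - F) * V) i j = u
  generalize (Uᴴ * F * V) i j = v
  have h3 : Complex.normSq (u + v) ≤ 2 * (Complex.normSq u + Complex.normSq v) := by
    simp only [Complex.normSq_apply, Complex.add_re, Complex.add_im]
    nlinarith [sq_nonneg (u.re - v.re), sq_nonneg (u.im - v.im)]
  have h4 : 0 ≤ min (a i) (l * b j) := le_min (ha i) (mul_nonneg hl (hb j))
  have h5 := mul_le_mul_of_nonneg_right (min_le_left (a i) (l * b j)) (Complex.normSq_nonneg u)
  have h6 := mul_le_mul_of_nonneg_right (min_le_right (a i) (l * b j)) (Complex.normSq_nonneg v)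
  nlinarith [mul_le_mul_of_nonneg_right h3 h4]

/-- A matrix bounded by `± c` has trace against `A` at most `c` times the trace norm of `A`. -/
lemma IsSpectralDecomp.trace_mul_le (hA : IsSpectralDecomp A U a) {G : Matrix m m ℂ} {c : ℝ}
    (h1 : ((c : ℂ) • 1 - G).PosSemidef) (h2 : (G + (c : ℂ) • 1).PosSemidef) :
    ((G * A).trace).re ≤ c * ∑ i, |a i| := by
  rw [hA.trace_mul, Finset.mul_sum]
  refine Finset.sum_le_sum fun i _ => ?_
  have e1 := (Complex.le_def.1 ((h1.conjTranspose_mul_mul_same U).diag_nonneg (i := i))).1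
  have e2 := (Complex.le_def.1 ((h2.conjTranspose_mul_mul_same U).diag_nonneg (i := i))).1
  simp only [Matrix.mul_sub, Matrix.sub_mul, Matrix.mul_add, Matrix.add_mul, Matrix.mul_smul,
    Matrix.smul_mul, hA.conj_mul, Matrix.sub_apply,
    Matrix.add_apply, Matrix.smul_apply, one_apply_eq, smul_eq_mul, mul_one,
    Complex.sub_re, Complex.add_re, Complex.ofReal_re, Complex.zero_re]
    at e1 e2
  have h3 : |((Uᴴ * G * U) i i).re| ≤ c := abs_le.2 ⟨by linarith, by linarith⟩
  calc _ ≤ |a i * ((Uᴴ * G * U) i i).re| := le_abs_self _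
    _ = |((Uᴴ * G * U) i i).re| * |a i| := by rw [abs_mul, mul_comm]
    _ ≤ _ := mul_le_mul_of_nonneg_right h3 (abs_nonneg _)

end

/-! ### Scalar inequalities -/

lemma sub_div_log_two_le {a b : ℝ} (ha : 0 < a) (hb : 0 < b) :
    (a - b) / Real.log 2 ≤ a * (Real.logb 2 a - Real.logb 2 b) := by
  have h2 : 0 < Real.log 2 := Real.log_pos one_lt_two
  have h := Real.log_le_sub_one_of_pos (div_pos hb ha)
  rw [Real.log_div hb.ne' ha.ne'] at h
  have h' : a * (Real.log b - Real.log a) ≤ b - a := by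
    calc _ ≤ a * (b / a - 1) := mul_le_mul_of_nonneg_left h ha.le
      _ = b - a := by field_simp
  rw [Real.logb, Real.logb, ← sub_div, ← mul_div_assoc]
  exact (div_le_div_iff_of_pos_right h2).2 (by linarith)

lemma mul_sub_logb_div_sub_le_min {a b L : ℝ} (ha : 0 < a) (hb : 0 < b) (hL : 0 < L) :
    a * (1 - (Real.logb 2 a - Real.logb 2 b) / L) - 2 * b / L ≤ min a ((2 : ℝ) ^ L * b) := by
  have h2 : 1 / 2 < Real.log 2 := by linarith [Real.log_two_gt_d9]
  set g := Real.logb 2 a - Real.logb 2 b with hg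
  have key : 0 ≤ a * g + 2 * b := by
    have h := sub_div_log_two_le ha hb
    have h3 : -(2 * b) ≤ (a - b) / Real.log 2 := by
      rw [le_div_iff₀ (by linarith)]
      nlinarith
    linarith
  have e : a * (1 - g / L) - 2 * b / L = a - (a * g + 2 * b) / L := by
    field_simp
    ring
  refine le_min ?_ ?_
  · rw [e]
    linarith [div_nonneg key hL.le]
  · have hb' : 0 < (2 : ℝ) ^ L * b := by positivity
    rcases le_or_gt g L with h | h
    · have h4 : a ≤ (2 : ℝ) ^ L * b := by
        rw [← Real.logb_le_logb one_lt_two ha hb', Real.logb_mul (by positivity) hb.ne',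
          Real.logb_rpow (by norm_num) (by norm_num)]
        linarith
      rw [e]
      linarith [div_nonneg key hL.le]
    · have h5 : 1 - g / L < 0 := by
        rw [sub_neg, one_lt_div hL]
        exact h
      have h6 : 0 ≤ 2 * b / L := by positivity
      nlinarith

/-! ### Relative entropy through the overlap distribution -/

lemma relEnt_eq {m : Type*} [Fintype m] [DecidableEq m] {ρ σ : Matrix m m ℂ}
    (hρ : ρ.IsHermitian) (hσ : σ.IsHermitian) :
    relEnt ρ σ = ∑ i, ∑ j, hρ.eigenvalues i * Complex.normSq
      (((hρ.eigenvectorUnitary : Matrix m m ℂ)ᴴ * (hσ.eigenvectorUnitary : Matrix m m ℂ)) i j) *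
      (Real.logb 2 (hρ.eigenvalues i) - Real.logb 2 (hσ.eigenvalues j)) := by
  have dρ := hρ.isSpectralDecomp
  have dσ := hσ.isSpectralDecomp
  have row := fun i => dρ.sum_overlap dσ i
  have lρ : hermLog2 ρ = (hρ.eigenvectorUnitary : Matrix m m ℂ) *
      diagonal (fun i => ((Real.logb 2 (hρ.eigenvalues i) : ℝ) : ℂ)) *
      (hρ.eigenvectorUnitary : Matrix m m ℂ)ᴴ := by rw [hermLog2, dif_pos hρ]; rfl
  have lσ : hermLog2 σ = (hσ.eigenvectorUnitary : Matrix m m ℂ) *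
      diagonal (fun i => ((Real.logb 2 (hσ.eigenvalues i) : ℝ) : ℂ)) *
      (hσ.eigenvectorUnitary : Matrix m m ℂ)ᴴ := by rw [hermLog2, dif_pos hσ]; rfl
  rw [relEnt, Matrix.trace_mul_comm, dρ.trace_mul]
  generalize (hρ.eigenvectorUnitary : Matrix m m ℂ) = U at *
  generalize (hσ.eigenvectorUnitary : Matrix m m ℂ) = V at *
  refine Finset.sum_congr rfl fun i _ => ?_
  simp_rw [mul_assoc (hρ.eigenvalues i), ← Finset.mul_sum]
  congr 1
  have e1 : Uᴴ * hermLog2 ρ * U = diagonal fun i => ((Real.logb 2 (hρ.eigenvalues i) : ℝ) : ℂ) := by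
    rw [lρ]
    calc _ = (Uᴴ * U) * (diagonal fun i => ((Real.logb 2 (hρ.eigenvalues i) : ℝ) : ℂ))
          * (Uᴴ * U) := by simp only [Matrix.mul_assoc]
      _ = _ := by rw [dρ.conj_mul, Matrix.one_mul, Matrix.mul_one]
  have e2 : Uᴴ * hermLog2 σ * U = (Uᴴ * V) *
      (diagonal fun i => ((Real.logb 2 (hσ.eigenvalues i) : ℝ) : ℂ)) * (Uᴴ * V)ᴴ := by
    rw [lσ, conjTranspose_mul, conjTranspose_conjTranspose]
    simp only [Matrix.mul_assoc]
  rw [Matrix.mul_sub, Matrix.sub_mul, Matrix.sub_apply, Complex.sub_re, e1, e2, diagonal_apply_eq,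
    Complex.ofReal_re]
  simp_rw [mul_sub]
  rw [Finset.sum_sub_distrib, ← Finset.sum_mul, row, one_mul]
  congr 1
  rw [Matrix.mul_apply, Complex.re_sum]
  refine Finset.sum_congr rfl fun j _ => ?_
  rw [mul_diagonal, conjTranspose_apply, mul_right_comm, Complex.re_mul_ofReal]
  congr 1
  exact (congrArg Complex.re (Complex.mul_conj _)).trans (Complex.ofReal_re _)

lemma eigenvalues_overlap_eq_zero {m : Type*} [Fintype m] [DecidableEq m] {A B U V : Matrix m m ℂ}
    {a b : m → ℝ} (hA : IsSpectralDecomp A U a) (hB : IsSpectralDecomp B V b)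
    (hsupp : ∀ v : m → ℂ, B *ᵥ v = 0 → A *ᵥ v = 0) {i j : m} (hj : b j = 0) :
    a i * Complex.normSq ((Uᴴ * V) i j) = 0 := by
  have h1 : B *ᵥ (V *ᵥ Pi.single j 1) = 0 := by
    rw [Matrix.mulVec_mulVec, hB.eq, Matrix.mul_assoc, hB.conj_mul, Matrix.mul_one,
      ← Matrix.mulVec_mulVec]
    have : (diagonal fun i => (b i : ℂ)) *ᵥ Pi.single j 1 = 0 := by
      ext k
      by_cases hk : k = j
      · subst hk
        simp [mulVec_diagonal, hj]
      · simp [mulVec_diagonal, hk]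
    rw [this, Matrix.mulVec_zero]
  have h2 := hsupp _ h1
  rw [Matrix.mulVec_mulVec, Matrix.mulVec_single_one] at h2
  have h3 : (Uᴴ * (A * V)) i j = 0 := by
    rw [Matrix.mul_apply]
    exact Finset.sum_eq_zero fun k _ => mul_eq_zero_of_right _ (congrFun h2 k)
  have e : Uᴴ * (A * V) = (diagonal fun i => (a i : ℂ)) * (Uᴴ * V) := by
    rw [hA.eq]
    calc _ = (Uᴴ * U) * ((diagonal fun i => (a i : ℂ)) * (Uᴴ * V)) := by
          simp only [Matrix.mul_assoc]
      _ = _ := by rw [hA.conj_mul, Matrix.one_mul]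
  rw [e, diagonal_mul] at h3
  rcases mul_eq_zero.1 h3 with h | h
  · rw [Complex.ofReal_eq_zero.1 h, zero_mul]
  · rw [h, map_zero, mul_zero]

/-- Lower bound on the minimal classical error for `n` copies, by Markov's inequality. -/
lemma one_sub_le_sum_min {ι κ : Type*} [Fintype ι] [Fintype κ] {a b : ι × κ → ℝ}
    {w : ι × κ → ι × κ → ℝ} (ha : ∀ i, 0 ≤ a i) (hb : ∀ i, 0 ≤ b i) (hw : ∀ i j, 0 ≤ w i j)
    (hP : ∑ i, ∑ j, a i * w i j = 1) (hQ : ∑ i, ∑ j, b j * w i j = 1)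
    (hsupp : ∀ i j, b j = 0 → a i * w i j = 0) (n : ℕ) {L : ℝ} (hL : 0 < L) :
    1 - (n * ∑ i, ∑ j, a i * w i j * (Real.logb 2 (a i) - Real.logb 2 (b j)) + 2) / L
      ≤ ∑ x : (Fin n → ι) × (Fin n → κ), ∑ y : (Fin n → ι) × (Fin n → κ),
        (∏ k, w (x.1 k, x.2 k) (y.1 k, y.2 k)) *
          min (∏ k, a (x.1 k, x.2 k)) ((2 : ℝ) ^ L * ∏ k, b (y.1 k, y.2 k)) := by
  have hPn := sum_sum_prod_pair (n := n) (fun _ i j => a i * w i j)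
  have hQn := sum_sum_prod_pair (n := n) (fun _ i j => b j * w i j)
  have hE := sum_sum_prod_mul_sum (n := n) (fun i j => a i * w i j)
    (fun i j => Real.logb 2 (a i) - Real.logb 2 (b j)) hP
  rw [hP, Finset.prod_const_one] at hPn
  rw [hQ, Finset.prod_const_one] at hQn
  have e : 1 - (n * ∑ i, ∑ j, a i * w i j * (Real.logb 2 (a i) - Real.logb 2 (b j)) + 2) / L
      = ∑ x : (Fin n → ι) × (Fin n → κ), ∑ y : (Fin n → ι) × (Fin n → κ),
        ((∏ k, a (x.1 k, x.2 k) * w (x.1 k, x.2 k) (y.1 k, y.2 k))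
          - ((∏ k, a (x.1 k, x.2 k) * w (x.1 k, x.2 k) (y.1 k, y.2 k)) *
            (∑ k, (Real.logb 2 (a (x.1 k, x.2 k)) - Real.logb 2 (b (y.1 k, y.2 k))))
            + (∏ k, b (y.1 k, y.2 k) * w (x.1 k, x.2 k) (y.1 k, y.2 k)) * 2) / L) := by
    have lin : ∀ p q r : (Fin n → ι) × (Fin n → κ) → (Fin n → ι) × (Fin n → κ) → ℝ,
        ∑ x, ∑ y, (p x y - (q x y + r x y * 2) / L)
          = ∑ x, ∑ y, p x y - (∑ x, ∑ y, q x y + (∑ x, ∑ y, r x y) * 2) / L := by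
      intro p q r
      simp_rw [Finset.sum_sub_distrib, ← Finset.sum_div, Finset.sum_add_distrib, ← Finset.sum_mul]
    rw [lin, hE, hPn, hQn, one_mul]
  rw [e]
  refine Finset.sum_le_sum fun x _ => Finset.sum_le_sum fun y _ => ?_
  have hbn : 0 ≤ ∏ k, b (y.1 k, y.2 k) := Finset.prod_nonneg fun k _ => hb _
  have han : 0 ≤ ∏ k, a (x.1 k, x.2 k) := Finset.prod_nonneg fun k _ => ha _
  have hwn : 0 ≤ ∏ k, w (x.1 k, x.2 k) (y.1 k, y.2 k) := Finset.prod_nonneg fun k _ => hw _ _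
  by_cases h0 : ∏ k, a (x.1 k, x.2 k) * w (x.1 k, x.2 k) (y.1 k, y.2 k) = 0
  · rw [h0, Finset.prod_mul_distrib, zero_mul, zero_add, zero_sub]
    refine le_trans (neg_nonpos.2 (by positivity)) (mul_nonneg hwn (le_min han ?_))
    positivity
  · have hk := Finset.prod_ne_zero_iff.1 h0
    have hak : ∀ k, a (x.1 k, x.2 k) ≠ 0 := fun k =>
      left_ne_zero_of_mul (hk k (Finset.mem_univ k))
    have hbk : ∀ k, b (y.1 k, y.2 k) ≠ 0 := fun k h => hk k (Finset.mem_univ k) (hsupp _ _ h)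
    have h1 := mul_sub_logb_div_sub_le_min
      (Finset.prod_pos fun k (_ : k ∈ Finset.univ) => lt_of_le_of_ne (ha _) (hak k).symm)
      (Finset.prod_pos fun k (_ : k ∈ Finset.univ) => lt_of_le_of_ne (hb _) (hbk k).symm) hL
    rw [Real.logb_prod _ _ fun k _ => hak k, Real.logb_prod _ _ fun k _ => hbk k,
      ← Finset.sum_sub_distrib] at h1
    refine le_trans (le_of_eq ?_) (mul_le_mul_of_nonneg_left h1 hwn)
    rw [Finset.prod_mul_distrib, Finset.prod_mul_distrib]
    ring

lemma IsSpectralDecomp.sum_mul_overlap {m : Type*} [Fintype m] [DecidableEq m]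
    {A B U V : Matrix m m ℂ} {a b : m → ℝ} (hA : IsSpectralDecomp A U a)
    (hB : IsSpectralDecomp B V b) :
    ∑ i, ∑ j, a i * Complex.normSq ((Uᴴ * V) i j) = ∑ i, a i := by
  simp_rw [← Finset.mul_sum, hA.sum_overlap hB, mul_one]

lemma IsSpectralDecomp.sum_mul_overlap' {m : Type*} [Fintype m] [DecidableEq m]
    {A B U V : Matrix m m ℂ} {a b : m → ℝ} (hA : IsSpectralDecomp A U a)
    (hB : IsSpectralDecomp B V b) :
    ∑ i, ∑ j, b j * Complex.normSq ((Uᴴ * V) i j) = ∑ j, b j := by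
  rw [Finset.sum_comm, ← hB.sum_mul_overlap hA]
  simp_rw [overlap_comm U V]

lemma sum_mul_logb_sub_logb_nonneg {m : Type*} [Fintype m] {a b : m → ℝ}
    {w : m → m → ℝ} (ha : ∀ i, 0 ≤ a i) (hb : ∀ i, 0 ≤ b i) (hw : ∀ i j, 0 ≤ w i j)
    (hP : ∑ i, ∑ j, a i * w i j = 1) (hQ : ∑ i, ∑ j, b j * w i j = 1)
    (hsupp : ∀ i j, b j = 0 → a i * w i j = 0) :
    0 ≤ ∑ i, ∑ j, a i * w i j * (Real.logb 2 (a i) - Real.logb 2 (b j)) := by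
  have h2 : 0 < Real.log 2 := Real.log_pos one_lt_two
  have e : 0 = ∑ i, ∑ j, (a i * w i j - b j * w i j) / Real.log 2 := by
    simp_rw [← Finset.sum_div, Finset.sum_sub_distrib]
    rw [hP, hQ, sub_self, zero_div]
  refine e.le.trans (Finset.sum_le_sum fun i _ => Finset.sum_le_sum fun j _ => ?_)
  by_cases h0 : a i * w i j = 0
  · rw [h0, zero_sub, zero_mul]
    exact div_nonpos_of_nonpos_of_nonneg (neg_nonpos.2 (mul_nonneg (hb j) (hw i j))) h2.le
  · have h1 := sub_div_log_two_le (lt_of_le_of_ne (ha i) (left_ne_zero_of_mul h0).symm)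
      (lt_of_le_of_ne (hb j) (Ne.symm fun h => h0 (hsupp i j h)))
    calc _ = w i j * ((a i - b j) / Real.log 2) := by ring
      _ ≤ _ := mul_le_mul_of_nonneg_left h1 (hw i j)
      _ = _ := by ring

lemma relEnt_nonneg {m : Type*} [Fintype m] [DecidableEq m] {ρ σ : Matrix m m ℂ}
    (hρ : ρ.PosSemidef) (hρtr : ρ.trace = 1) (hσ : σ.PosSemidef) (hσtr : σ.trace = 1)
    (hsupp : ∀ v : m → ℂ, σ *ᵥ v = 0 → ρ *ᵥ v = 0) : 0 ≤ relEnt ρ σ := by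
  have dρ := hρ.1.isSpectralDecomp
  have dσ := hσ.1.isSpectralDecomp
  rw [relEnt_eq hρ.1 hσ.1]
  exact sum_mul_logb_sub_logb_nonneg hρ.eigenvalues_nonneg hσ.eigenvalues_nonneg
    (fun i j => Complex.normSq_nonneg _)
    (by rw [dρ.sum_mul_overlap dσ, ← dρ.trace_eq, hρtr, Complex.one_re])
    (by rw [dρ.sum_mul_overlap' dσ, ← dσ.trace_eq, hσtr, Complex.one_re])
    (fun i j hj => eigenvalues_overlap_eq_zero dρ dσ hsupp hj)

/-! ### The bound on the fidelity -/

lemma FGamma_tpow_le {ι κ : Type*} [Fintype ι] [Fintype κ] [DecidableEq ι] [DecidableEq κ]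
    {ρ σ U V T : Matrix (ι × κ) (ι × κ) ℂ} {a b c : ι × κ → ℝ}
    (dρ : IsSpectralDecomp ρ U a) (dσ : IsSpectralDecomp σ V b)
    (dτ : IsSpectralDecomp (ptrans σ) T c)
    (ha : ∀ i, 0 ≤ a i) (hb : ∀ i, 0 ≤ b i) (hasum : ∑ i, a i = 1) (hbsum : ∑ i, b i = 1)
    (hsupp : ∀ v : ι × κ → ℂ, σ *ᵥ v = 0 → ρ *ᵥ v = 0)
    (n : ℕ) {K L : ℝ} (hK : 0 ≤ K) (hL : 0 < L) :
    FGamma (tpow ρ n) K ≤ 1 + (2 : ℝ) ^ L * (1 / K * (∑ i, |c i|) ^ n)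
      - (1 - (n * ∑ i, ∑ j, a i * Complex.normSq ((Uᴴ * V) i j) *
          (Real.logb 2 (a i) - Real.logb 2 (b j)) + 2) / L) / 2 := by
  refine csSup_le ⟨_, 0, .zero, by simpa using PosSemidef.one, ?_, ?_, rfl⟩ ?_
  · have : (0 : ℂ) ≤ ((1 / K : ℝ) : ℂ) := Complex.zero_le_real.2 (by positivity)
    simpa [show ptrans (0 : Matrix ((Fin n → ι) × (Fin n → κ)) ((Fin n → ι) × (Fin n → κ)) ℂ) = 0
      from rfl] using PosSemidef.one.smul this
  · have : (0 : ℂ) ≤ ((1 / K : ℝ) : ℂ) := Complex.zero_le_real.2 (by positivity)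
    simpa [show ptrans (0 : Matrix ((Fin n → ι) × (Fin n → κ)) ((Fin n → ι) × (Fin n → κ)) ℂ) = 0
      from rfl] using PosSemidef.one.smul this
  rintro _ ⟨F, hF, hF1, hG1, hG2, rfl⟩
  have hq : ((F * tpow σ n).trace).re ≤ 1 / K * (∑ i, |c i|) ^ n := by
    rw [← trace_ptrans_mul_ptrans, ptrans_tpow]
    refine ((dτ.tpow n).trace_mul_le hG1 hG2).trans (le_of_eq ?_)
    have := sum_prod_pair (n := n) (fun _ i => |c i|)
    simp_rw [Finset.abs_prod]
    rw [this, Finset.prod_const, Finset.card_univ, Fintype.card_fin]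
  have hns := (dρ.tpow n).nussbaum_szkola (dσ.tpow n)
    (fun x => Finset.prod_nonneg fun k _ => ha _) (fun x => Finset.prod_nonneg fun k _ => hb _)
    hF hF1 (l := (2 : ℝ) ^ L) (by positivity)
  have hmin := one_sub_le_sum_min (w := fun i j => Complex.normSq ((Uᴴ * V) i j)) ha hb
    (fun i j => Complex.normSq_nonneg _)
    (by rw [dρ.sum_mul_overlap dσ, hasum]) (by rw [dρ.sum_mul_overlap' dσ, hbsum])
    (fun i j hj => eigenvalues_overlap_eq_zero dρ dσ hsupp hj) n hL
  have hW : ∀ x y, Complex.normSq (((tpow U n)ᴴ * tpow V n) x y)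
      = ∏ k, Complex.normSq ((Uᴴ * V) (x.1 k, x.2 k) (y.1 k, y.2 k)) := fun x y => by
    rw [← tpow_conjTranspose, ← tpow_mul, tpow, map_prod]
  simp_rw [hW] at hns
  have htr : ((tpow ρ n).trace).re = 1 := by
    rw [(dρ.tpow n).trace_eq, sum_prod_pair (fun _ i => a i), hasum, Finset.prod_const_one]
  rw [Matrix.sub_mul, Matrix.one_mul, Matrix.trace_sub, Complex.sub_re, htr] at hns
  have hq' := mul_le_mul_of_nonneg_left hq (by positivity : (0 : ℝ) ≤ (2 : ℝ) ^ L)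
  linarith

/-- The combined bound: `D_Γ(ρ) ≤ S(ρ‖σ) + log₂ Tr|σ^Γ|` for any state `σ`
whose support contains the support of `ρ`. -/
theorem DGamma_le_relEnt_add_logNegativity {a b : ℕ}
    (ρ σ : Matrix (Fin a × Fin b) (Fin a × Fin b) ℂ)
    (hρ : ρ.PosSemidef) (hρtr : ρ.trace = 1)
    (hσ : σ.PosSemidef) (hσtr : σ.trace = 1)
    (hsupp : ∀ v : (Fin a × Fin b) → ℂ, σ *ᵥ v = 0 → ρ *ᵥ v = 0) :
    DGamma ρ ≤ relEnt ρ σ + Real.logb 2 (traceAbs (ptrans σ)) := by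
  have dρ := hρ.1.isSpectralDecomp
  have dσ := hσ.1.isSpectralDecomp
  have hτ := ptrans_isHermitian hσ.1
  have dτ := hτ.isSpectralDecomp
  have ha := hρ.eigenvalues_nonneg
  have hb := hσ.eigenvalues_nonneg
  have hasum : ∑ i, hρ.1.eigenvalues i = 1 := by rw [← dρ.trace_eq, hρtr, Complex.one_re]
  have hbsum : ∑ i, hσ.1.eigenvalues i = 1 := by rw [← dσ.trace_eq, hσtr, Complex.one_re]
  have hcsum : 1 ≤ ∑ i, |hτ.eigenvalues i| := by
    rw [← Complex.one_re, ← hσtr, ← trace_ptrans, dτ.trace_eq]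
    exact Finset.sum_le_sum fun i _ => le_abs_self _
  have hS0 := relEnt_nonneg hρ hρtr hσ hσtr hsupp
  have hbound := fun (n : ℕ) (K L : ℝ) (hK : 0 ≤ K) (hL : 0 < L) =>
    FGamma_tpow_le dρ dσ dτ ha hb hasum hbsum hsupp n hK hL
  rw [← relEnt_eq hρ.1 hσ.1] at hbound
  rw [traceAbs, dif_pos hτ]
  generalize relEnt ρ σ = S at *
  generalize ∑ i, |hτ.eigenvalues i| = T at *
  have hT0 : 0 < T := by linarith
  refine Real.sSup_le ?_ (add_nonneg hS0 (Real.logb_nonneg one_lt_two hcsum))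
  rintro r ⟨hr0, hr⟩
  by_contra! hlt
  obtain ⟨x, hx1, hx2⟩ := exists_between (lt_sub_iff_add_lt.2 hlt)
  have hx0 : 0 < x := hS0.trans_lt hx1
  have hle : ∀ᶠ n : ℕ in atTop, FGamma (tpow ρ n) ((⌊(2 : ℝ) ^ (r * (n : ℝ))⌋ : ℤ) : ℝ)
      ≤ 1 + 2 * ((2 : ℝ) ^ (x + Real.logb 2 T - r)) ^ n
        - (1 - (S / x + 2 / x * (1 / (n : ℝ)))) / 2 := by
    filter_upwards [eventually_gt_atTop 0] with n hn
    have hn' : (0 : ℝ) < n := Nat.cast_pos.2 hn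
    have hM : (1 : ℝ) ≤ (2 : ℝ) ^ (r * (n : ℝ)) := Real.one_le_rpow one_le_two (by positivity)
    set M := (2 : ℝ) ^ (r * (n : ℝ)) with hMdef
    have hfl1 : (1 : ℝ) ≤ (⌊M⌋ : ℤ) := by exact_mod_cast Int.le_floor.2 (by simpa using hM)
    have hfl2 : M / 2 ≤ (⌊M⌋ : ℤ) := by linarith [Int.lt_floor_add_one M]
    refine (hbound n _ (x * n) (by linarith) (by positivity)).trans ?_
    have h1 : (1 : ℝ) / (⌊M⌋ : ℤ) ≤ 2 / M := by
      rw [div_le_div_iff₀ (by linarith) (by linarith)]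
      linarith
    have h2 : (2 : ℝ) ^ (x * n) * (2 / M * T ^ n)
        = 2 * ((2 : ℝ) ^ (x + Real.logb 2 T - r)) ^ n := by
      rw [Real.rpow_sub two_pos, Real.rpow_add two_pos,
        Real.rpow_logb two_pos (by norm_num) hT0, div_pow, mul_pow, hMdef,
        Real.rpow_mul two_pos.le, Real.rpow_mul two_pos.le, Real.rpow_natCast, Real.rpow_natCast]
      ring
    have h3 : (2 : ℝ) ^ (x * n) * (1 / (⌊M⌋ : ℤ) * T ^ n)
        ≤ (2 : ℝ) ^ (x * n) * (2 / M * T ^ n) := by gcongr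
    have h4 : (n * S + 2) / (x * n) = S / x + 2 / x * (1 / (n : ℝ)) := by
      field_simp
    rw [h4]
    linarith
  have hδ1 : (2 : ℝ) ^ (x + Real.logb 2 T - r) < 1 :=
    Real.rpow_lt_one_of_one_lt_of_neg one_lt_two (by linarith)
  have hlim : Tendsto (fun n : ℕ => 1 + 2 * ((2 : ℝ) ^ (x + Real.logb 2 T - r)) ^ n
        - (1 - (S / x + 2 / x * (1 / (n : ℝ)))) / 2) atTop
      (nhds (1 + 2 * 0 - (1 - (S / x + 2 / x * 0)) / 2)) :=
    ((tendsto_pow_atTop_nhds_zero_of_lt_one (by positivity) hδ1).const_mul 2 |>.const_add 1).sub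
      (((tendsto_one_div_atTop_nhds_zero_nat (𝕜 := ℝ)).const_mul (2 / x) |>.const_add (S / x)
        |>.const_sub 1).div_const 2)
  have hfin := le_of_tendsto_of_tendsto hr hlim hle
  have hSx : S / x < 1 := (div_lt_one hx0).2 hx1
  linarith
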